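/- arXiv:2306.02365 — 2 statements merged into one kernel-verified Lean document; each statement's English description precedes it below -/
import Mathlib

section
/- Let B be a unital C*-algebra, let A ⊆ B be a unital norm-closed subalgebra, and let ω be a pure state on B whose restriction to A admits a unique state extension to B (i.e., ω is the only state on B agreeing with ω on A). Then for every α > 0, ω is an (A,α)-pinnacle state: for every weak-* compact subset K of the state space S(B) with ω ∉ K, there exists a ∈ A with ω(a*a) = 1, ‖a‖ ≤ 1 + α, and ψ(a*a) < 1 for every ψ ∈ K. -/
noncomputable section

open scoped ComplexOrder

variable {B : Type*} [NormedRing B] [StarRing B] [CStarRing B] [NormedAlgebra ℂ B]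
  [StarModule ℂ B] [CompleteSpace B]

/-- A state on `B`, as a (weak-*) continuous linear functional: unital and contractive. -/
def IsStateW (φ : WeakDual ℂ B) : Prop :=
  φ 1 = 1 ∧ ∀ b : B, ‖φ b‖ ≤ ‖b‖

/-- The state space of `B`, inside the weak-* dual. -/
def stateSpace (B : Type*) [NormedRing B] [StarRing B] [CStarRing B] [NormedAlgebra ℂ B]
    [StarModule ℂ B] [CompleteSpace B] : Set (WeakDual ℂ B) :=
  {φ | IsStateW φ}

/-- A pure state on `B`: an extreme point of the state space. -/
def IsPureStateW (φ : WeakDual ℂ B) : Prop :=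
  φ ∈ Set.extremePoints ℝ (stateSpace B)

open Set Filter Topology

/-- **Milman's converse**, in a form convenient for separation: a compact set missing an extreme
point of a convex compact set `S` lies in a compact convex subset of `S` missing that point. -/
theorem exists_isCompact_convex_superset_of_mem_extremePoints {E : Type*} [AddCommGroup E]
    [Module ℝ E] [TopologicalSpace E] [IsTopologicalAddGroup E] [ContinuousSMul ℝ E]
    [LocallyConvexSpace ℝ E] [T2Space E] {S K : Set E} (hS : IsCompact S) (hSc : Convex ℝ S)
    (hKS : K ⊆ S) (hK : IsCompact K) {x : E} (hx : x ∈ S.extremePoints ℝ) (hxK : x ∉ K) :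
    ∃ D ⊆ S, IsCompact D ∧ Convex ℝ D ∧ x ∉ D ∧ K ⊆ D := by
  refine hK.induction_on
    (p := fun s ↦ ∃ D ⊆ S, IsCompact D ∧ Convex ℝ D ∧ x ∉ D ∧ s ∩ K ⊆ D) ?_ ?_ ?_ ?_ |>.imp ?_
  · exact ⟨∅, empty_subset _, isCompact_empty, convex_empty, by simp, by simp⟩
  · rintro s t hst ⟨D, h1, h2, h3, h4, h5⟩
    exact ⟨D, h1, h2, h3, h4, (inter_subset_inter_left K hst).trans h5⟩
  · rintro s t ⟨D, hDS, hD, hDc, hxD, hsD⟩ ⟨D', hDS', hD', hDc', hxD', htD'⟩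
    rcases D.eq_empty_or_nonempty with rfl | hne
    · refine ⟨D', hDS', hD', hDc', hxD', ?_⟩
      rw [union_inter_distrib_right]
      exact union_subset (hsD.trans (empty_subset _)) htD'
    rcases D'.eq_empty_or_nonempty with rfl | hne'
    · refine ⟨D, hDS, hD, hDc, hxD, ?_⟩
      rw [union_inter_distrib_right]
      exact union_subset hsD (htD'.trans (empty_subset _))
    refine ⟨convexJoin ℝ D D', ?_, ?_, hDc.convexJoin hDc', ?_, ?_⟩
    · exact convexJoin_subset hDS hDS' hSc
    · have him : convexJoin ℝ D D' =
          (fun p : (E × E) × ℝ ↦ (1 - p.2) • p.1.1 + p.2 • p.1.2) '' ((D ×ˢ D') ×ˢ Icc 0 1) := by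
        ext z
        simp only [mem_convexJoin, segment_eq_image, mem_image, mem_prod, Prod.exists]
        constructor
        · rintro ⟨a, ha, b, hb, r, hr, rfl⟩
          exact ⟨a, b, r, ⟨⟨ha, hb⟩, hr⟩, rfl⟩
        · rintro ⟨a, b, r, ⟨⟨ha, hb⟩, hr⟩, rfl⟩
          exact ⟨a, ha, b, hb, r, hr, rfl⟩
      rw [him]
      exact ((hD.prod hD').prod isCompact_Icc).image (by fun_prop)
    · rw [mem_convexJoin]
      rintro ⟨a, ha, b, hb, hab⟩
      rcases (mem_extremePoints_iff_forall_segment.1 hx).2 a (hDS ha) b (hDS' hb) hab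
        with rfl | rfl
      exacts [hxD ha, hxD' hb]
    · rw [union_inter_distrib_right]
      exact union_subset (hsD.trans (subset_convexJoin_left hne'))
        (htD'.trans (subset_convexJoin_right hne))
  · intro k hk
    obtain ⟨f, hf⟩ := geometric_hahn_banach_point_point (E := E) (x := x) (y := k)
      (fun h ↦ hxK (h ▸ hk))
    obtain ⟨u, hxu, huk⟩ := exists_between hf
    refine ⟨{y | u < f y}, mem_nhdsWithin_of_mem_nhds
      ((isOpen_lt continuous_const f.continuous).mem_nhds huk), S ∩ {y | u ≤ f y},
      inter_subset_left, hS.inter_right (isClosed_le continuous_const f.continuous),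
      hSc.inter (convex_halfSpace_ge f.toLinearMap.isLinear u), fun h ↦ hxu.not_ge h.2,
      fun y hy ↦ ⟨hKS hy.2, (mem_ofPred.1 hy.1).le⟩⟩
  · rintro D ⟨h1, h2, h3, h4, h5⟩
    exact ⟨h1, h2, h3, h4, by simpa using h5⟩

theorem convex_stateSpace : Convex ℝ (stateSpace B) := by
  rintro φ ⟨h1, h2⟩ ψ ⟨h3, h4⟩ s t hs ht hst
  have key (b : B) : (s • φ + t • ψ) b = s * φ b + t * ψ b := rfl
  refine ⟨?_, fun b ↦ ?_⟩
  · rw [key, h1, h3]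
    exact_mod_cast (by simpa using hst)
  · rw [key]
    calc ‖(s : ℂ) * φ b + t * ψ b‖ ≤ s * ‖φ b‖ + t * ‖ψ b‖ := by
          refine (norm_add_le _ _).trans_eq ?_
          simp [abs_of_nonneg hs, abs_of_nonneg ht]
      _ ≤ s * ‖b‖ + t * ‖b‖ := by gcongr <;> simp_all
      _ = ‖b‖ := by rw [← add_mul, hst, one_mul]

theorem isCompact_stateSpace : IsCompact (stateSpace B) := by
  have hc : IsClosed (stateSpace B) := by
    have : stateSpace B = {φ | φ 1 = 1} ∩ ⋂ b : B, {φ | ‖φ b‖ ≤ ‖b‖} := by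
      ext φ; simp [stateSpace, IsStateW]
    rw [this]
    exact (isClosed_eq (WeakDual.eval_continuous _) continuous_const).inter
      (isClosed_iInter fun b ↦ isClosed_le (WeakDual.eval_continuous b).norm continuous_const)
  refine (WeakDual.isCompact_closedBall (𝕜 := ℂ) (E := B) 0 1).of_isClosed_subset hc ?_
  intro φ hφ
  simp only [mem_preimage, mem_closedBall_zero_iff]
  exact ContinuousLinearMap.opNorm_le_bound _ zero_le_one fun b ↦ by
    simpa using hφ.2 b

theorem IsStateW.im_eq_zero {φ : WeakDual ℂ B} (hφ : IsStateW φ) {h : B} (hh : star h = h) :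
    (φ h).im = 0 := by
  have key (s : ℝ) : ((φ h).im + s) ^ 2 ≤ ‖h‖ ^ 2 + s ^ 2 * ‖(1 : B)‖ := by
    set y : B := h + (Complex.I * s) • 1
    have hy : star y * y = h * h + ((s : ℂ) ^ 2) • 1 := by
      simp only [y, star_add, hh, star_smul, star_one, Complex.star_def, map_mul,
        Complex.conj_I, Complex.conj_ofReal]
      simp only [mul_add, add_mul, smul_mul_assoc, mul_smul_comm, one_mul, mul_one, smul_add,
        smul_smul]
      rw [show Complex.I * (s : ℂ) * (-Complex.I * s) = s ^ 2 by
        linear_combination (-(s : ℂ) ^ 2) * Complex.I_sq]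
      module
    have h1 : ‖y‖ ^ 2 ≤ ‖h‖ ^ 2 + s ^ 2 * ‖(1 : B)‖ := by
      rw [sq, ← CStarRing.norm_star_mul_self, hy]
      refine (norm_add_le _ _).trans (add_le_add ((norm_mul_le _ _).trans_eq (sq _).symm) ?_)
      rw [norm_smul]
      simp
    have h2 : (φ y).im = (φ h).im + s := by
      simp [y, map_add, map_smul, hφ.1]
    rw [← h2]
    refine le_trans ?_ h1
    have := (Complex.abs_im_le_norm (φ y)).trans (hφ.2 y)
    exact sq_le_sq' (abs_le.1 this).1 (abs_le.1 this).2
  have : Nontrivial B := ⟨1, 0, fun h0 ↦ by simpa [h0] using hφ.1⟩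
  simp only [CStarRing.norm_one, mul_one] at key
  by_contra h0
  set q := (φ h).im
  have h3 := key ((‖h‖ ^ 2 + 1) / (2 * q))
  have h4 : 2 * q * ((‖h‖ ^ 2 + 1) / (2 * q)) = ‖h‖ ^ 2 + 1 := by field_simp
  nlinarith [sq_nonneg q]

theorem IsStateW.re_star {φ : WeakDual ℂ B} (hφ : IsStateW φ) (c : B) :
    (φ (star c)).re = (φ c).re := by
  have h := hφ.im_eq_zero (h := Complex.I • (c - star c)) (by
    rw [star_smul, star_sub, star_star, Complex.star_def, Complex.conj_I]
    module)
  simp [map_smul, map_sub] at h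
  linarith

theorem IsStateW.abs_re_star_mul_self_one_sub_smul {φ : WeakDual ℂ B} (hφ : IsStateW φ)
    (c : B) (t : ℝ) :
    |(φ (star (1 - (t : ℂ) • c) * (1 - (t : ℂ) • c))).re - (1 - 2 * t * (φ c).re)|
      ≤ t ^ 2 * ‖c‖ ^ 2 := by
  have hx : star (1 - (t : ℂ) • c) * (1 - (t : ℂ) • c) =
      1 - (t : ℂ) • c - (t : ℂ) • star c + ((t ^ 2 : ℝ) : ℂ) • (star c * c) := by
    simp only [star_sub, star_one, star_smul, Complex.star_def, Complex.conj_ofReal, mul_sub,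
      sub_mul, smul_mul_assoc, mul_smul_comm, one_mul, mul_one]
    push_cast
    module
  rw [hx]
  simp only [map_add, map_sub, map_smul, hφ.1, smul_eq_mul, Complex.add_re, Complex.sub_re,
    Complex.re_ofReal_mul, Complex.one_re, hφ.re_star]
  rw [show 1 - t * (φ c).re - t * (φ c).re + t ^ 2 * (φ (star c * c)).re
    - (1 - 2 * t * (φ c).re) = t ^ 2 * (φ (star c * c)).re by ring, abs_mul, abs_sq]
  gcongr
  refine (Complex.abs_re_le_norm _).trans ((hφ.2 _).trans_eq ?_)
  rw [CStarRing.norm_star_mul_self, sq]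

/-- A pure state determined by its restriction to `A` is strictly separated by an element of `A`
from any compact set of states not containing it. -/
theorem IsPureStateW.exists_mem_forall_re_lt {A : Subalgebra ℂ B} {ω : WeakDual ℂ B}
    (hω : IsPureStateW ω)
    (huniq : ∀ ψ : WeakDual ℂ B, IsStateW ψ → (∀ a ∈ A, ψ a = ω a) → ψ = ω)
    {K : Set (WeakDual ℂ B)} (hK : K ⊆ stateSpace B) (hKcpt : IsCompact K) (hωK : ω ∉ K) :
    ∃ c ∈ A, ∃ u : ℝ, (ω c).re < u ∧ ∀ ψ ∈ K, u < (ψ c).re := by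
  have : LocallyConvexSpace ℝ (WeakDual ℂ B) := inferInstanceAs
    (LocallyConvexSpace ℝ (WeakBilin (topDualPairing ℂ B)))
  have : IsScalarTower ℝ ℂ (WeakDual ℂ A) :=
    ⟨fun r z φ ↦ DFunLike.ext _ _ fun a ↦ smul_assoc r z (φ a)⟩
  have : LocallyConvexSpace ℝ (WeakDual ℂ A) := inferInstanceAs
    (LocallyConvexSpace ℝ (WeakBilin (topDualPairing ℂ A)))
  have exists_superset := exists_isCompact_convex_superset_of_mem_extremePoints
    (E := WeakDual ℂ B) (S := stateSpace B) (K := K) (x := ω)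
  obtain ⟨D, hDS, hD, hDc, hωD, hKD⟩ :=
    exists_superset isCompact_stateSpace convex_stateSpace hK hKcpt hω hωK
  let R : WeakDual ℂ B →L[ℂ] WeakDual ℂ A :=
    { toFun := fun φ ↦ ContinuousLinearMap.comp φ A.toSubmodule.subtypeL
      map_add' := fun _ _ ↦ rfl
      map_smul' := fun _ _ ↦ rfl
      cont := WeakDual.continuous_of_continuous_eval fun a ↦ WeakDual.eval_continuous (a : B) }
  have hωR : R ω ∉ R '' D := by
    rintro ⟨ψ, hψ, hψω⟩
    refine hωD (huniq ψ (hDS hψ) (fun a ha ↦ ?_) ▸ hψ)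
    exact DFunLike.congr_fun hψω (⟨a, ha⟩ : A)
  have hRD : Convex ℝ (R '' D) := by
    rintro _ ⟨φ, hφ, rfl⟩ _ ⟨ψ, hψ, rfl⟩ s t hs ht hst
    exact ⟨s • φ + t • ψ, hDc hφ hψ hs ht hst, rfl⟩
  have separation := RCLike.geometric_hahn_banach_point_closed (𝕜 := ℂ) (E := WeakDual ℂ A)
    (x := R ω) (t := R '' D)
  obtain ⟨f, u, h1, h2⟩ := separation hRD (hD.image R.continuous).isClosed hωR
  obtain ⟨c, rfl⟩ := LinearMap.dualEmbedding_surjective (topDualPairing ℂ A) f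
  exact ⟨c, c.2, u, h1, fun ψ hψ ↦ h2 _ (mem_image_of_mem R (hKD hψ))⟩

theorem exists_pos_perturbation_bounds {m u N n α : ℝ} (hmu : m < u) (hα : 0 < α) :
    ∃ t : ℝ, 0 < t ∧ t * N < u - m ∧ 0 < 1 - 2 * t * m - t ^ 2 * N ∧
      (1 + t * n) ^ 2 < (1 + α) ^ 2 * (1 - 2 * t * m - t ^ 2 * N) := by
  have h1 : ∀ᶠ t : ℝ in 𝓝 0, t * N < u - m :=
    (by fun_prop : Continuous fun t : ℝ ↦ t * N).continuousAt.eventually_lt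
      continuousAt_const (by simpa using hmu)
  have h2 : ∀ᶠ t : ℝ in 𝓝 0, 0 < 1 - 2 * t * m - t ^ 2 * N :=
    continuousAt_const.eventually_lt
      (by fun_prop : Continuous fun t : ℝ ↦ 1 - 2 * t * m - t ^ 2 * N).continuousAt (by simp)
  have h3 : ∀ᶠ t : ℝ in 𝓝 0, (1 + t * n) ^ 2 < (1 + α) ^ 2 * (1 - 2 * t * m - t ^ 2 * N) :=
    (by fun_prop : Continuous fun t : ℝ ↦ (1 + t * n) ^ 2).continuousAt.eventually_lt
      (by fun_prop : Continuous fun t : ℝ ↦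
        (1 + α) ^ 2 * (1 - 2 * t * m - t ^ 2 * N)).continuousAt (by
        norm_num
        exact lt_abs.2 (Or.inl (by linarith)))
  have h : ∀ᶠ t : ℝ in 𝓝[>] 0, _ := nhdsWithin_le_nhds ((h1.and h2).and h3)
  obtain ⟨t, ⟨⟨ht1, ht2⟩, ht3⟩, ht⟩ := (h.and self_mem_nhdsWithin).exists
  exact ⟨t, ht, ht1, ht2, ht3⟩

theorem stmt10 (A : Subalgebra ℂ B) (hAclosed : IsClosed (A : Set B))
    (ω : WeakDual ℂ B) (hω : IsPureStateW ω)
    (huniq : ∀ ψ : WeakDual ℂ B, IsStateW ψ → (∀ a ∈ A, ψ a = ω a) → ψ = ω)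
    (α : ℝ) (hα : 0 < α)
    (K : Set (WeakDual ℂ B)) (hK : K ⊆ stateSpace B) (hKcpt : IsCompact K) (hωK : ω ∉ K) :
    ∃ a ∈ A, ω (star a * a) = 1 ∧ ‖a‖ ≤ 1 + α ∧ ∀ ψ ∈ K, ψ (star a * a) < 1 := by
  obtain ⟨c, hcA, u, hωu, hKu⟩ := hω.exists_mem_forall_re_lt huniq hK hKcpt hωK
  obtain ⟨t, ht, ht1, ht2, ht3⟩ :=
    exists_pos_perturbation_bounds (N := ‖c‖ ^ 2) (n := ‖c‖) hωu hα
  have hωS : IsStateW ω := hω.1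
  have : Nontrivial B := ⟨1, 0, fun h0 ↦ by simpa [h0] using hωS.1⟩
  set x : B := 1 - (t : ℂ) • c with hx
  have hval {φ : WeakDual ℂ B} (hφ : IsStateW φ) :
      φ (star x * x) = ((φ (star x * x)).re : ℂ) := by
    apply Complex.ext
    · simp
    · simpa using hφ.im_eq_zero (by simp)
  have hest {φ : WeakDual ℂ B} (hφ : IsStateW φ) :=
    abs_le.1 (hφ.abs_re_star_mul_self_one_sub_smul c t)
  set w := (ω (star x * x)).re with hw
  have hwt : 1 - 2 * t * (ω c).re - t ^ 2 * ‖c‖ ^ 2 ≤ w := by linarith [(hest hωS).1]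
  have hw0 : 0 < w := ht2.trans_le hwt
  have hmul (φ : WeakDual ℂ B) : φ (star (((√w)⁻¹ : ℂ) • x) * (((√w)⁻¹ : ℂ) • x)) =
      ((w⁻¹ : ℝ) : ℂ) * φ (star x * x) := by
    have hsq : ((√w)⁻¹ : ℂ) * ((√w)⁻¹ : ℂ) = ((w⁻¹ : ℝ) : ℂ) := by
      rw [← mul_inv]
      exact_mod_cast congrArg (·⁻¹) (Real.mul_self_sqrt hw0.le)
    rw [star_smul, star_inv₀, Complex.star_def, Complex.conj_ofReal, smul_mul_smul_comm,
      hsq, map_smul, smul_eq_mul]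
  refine ⟨((√w)⁻¹ : ℂ) • x, A.smul_mem (A.sub_mem A.one_mem (A.smul_mem hcA _)) _, ?_, ?_, ?_⟩
  · rw [hmul, hval hωS, ← hw]
    exact_mod_cast inv_mul_cancel₀ hw0.ne'
  · have hxn : ‖x‖ ≤ 1 + t * ‖c‖ := by
      refine (norm_sub_le _ _).trans_eq ?_
      simp [norm_smul, abs_of_pos ht]
    have hle : 1 + t * ‖c‖ ≤ (1 + α) * √w := by
      refine le_of_sq_le_sq ?_ (by positivity)
      rw [mul_pow, Real.sq_sqrt hw0.le]
      exact ht3.le.trans (by gcongr)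
    rw [norm_smul, norm_inv, Complex.norm_real, Real.norm_of_nonneg (Real.sqrt_nonneg w),
      inv_mul_le_iff₀ (Real.sqrt_pos.2 hw0), mul_comm]
    exact hxn.trans hle
  · intro ψ hψ
    have hlt : (ψ (star x * x)).re < w := by
      have h1 := (hest (hK hψ)).2
      have h2 := mul_lt_mul_of_pos_left (hKu ψ hψ) ht
      have h3 := mul_lt_mul_of_pos_left ht1 ht
      nlinarith
    rw [hmul, hval (hK hψ), ← Complex.ofReal_mul, ← Complex.ofReal_one, Complex.real_lt_real,
      inv_mul_lt_iff₀ hw0, mul_one]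
    exact hlt
end
end

section
/- Let B be a unital C*-algebra and let ω be a state on B. If ω admits an excision, i.e., there exist a directed set Λ and a family (e_λ)_{λ∈Λ} of elements of B with ‖e_λ‖ ≤ 1 for all λ, lim_λ ω(e_λ) = 1, and lim_λ ‖e_λ* (b − ω(b)·1) e_λ‖ = 0 for every b ∈ B, then ω is a pure state. -/
noncomputable section

open scoped ComplexOrder

variable {B : Type*} [NormedRing B] [StarRing B] [CStarRing B] [NormedAlgebra ℂ B]
  [StarModule ℂ B] [CompleteSpace B]

/-- A state on `B`: a unital contractive linear functional. -/
def IsState (φ : B →ₗ[ℂ] ℂ) : Prop :=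
  φ 1 = 1 ∧ ∀ b : B, ‖φ b‖ ≤ ‖b‖

/-- A pure state on `B`: an extreme point of the convex set of states on `B`. -/
def IsPureState (φ : B →ₗ[ℂ] ℂ) : Prop :=
  φ ∈ Set.extremePoints ℝ {ψ : B →ₗ[ℂ] ℂ | IsState ψ}

/-- A state takes real values on self-adjoint elements. -/
lemma IsState.im_eq_zero {φ : B →ₗ[ℂ] ℂ} (hφ : IsState φ) {a : B} (ha : star a = a) :
    (φ a).im = 0 := by
  have key : ∀ t : ℝ, ((φ a).im + t) ^ 2 ≤ ‖a‖ ^ 2 + t ^ 2 * ‖(1 : B)‖ := fun t => by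
    set x : B := a + ((t : ℂ) * Complex.I) • (1 : B) with hx
    have hmul : star x * x = a * a + ((t : ℂ) ^ 2) • (1 : B) := by
      have hI : (t : ℂ) * Complex.I * ((t : ℂ) * Complex.I) = -(t : ℂ) ^ 2 := by
        linear_combination (t : ℂ) ^ 2 * Complex.I_mul_I
      simp [hx, ha, add_mul, mul_add, smul_smul, hI]
    have hnorm : ‖x‖ ^ 2 ≤ ‖a‖ ^ 2 + t ^ 2 * ‖(1 : B)‖ := by
      rw [sq ‖x‖, ← CStarRing.norm_star_mul_self, hmul]
      refine (norm_add_le _ _).trans (add_le_add ?_ ?_)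
      · simpa [sq] using norm_mul_le a a
      · simp [norm_smul]
    have him : (φ a).im + t = (φ x).im := by simp [hx, hφ.1]
    have h1 : |(φ x).im| ≤ ‖x‖ := (Complex.abs_im_le_norm _).trans (hφ.2 x)
    rw [him, ← sq_abs]
    exact (pow_le_pow_left₀ (abs_nonneg _) h1 2).trans hnorm
  have hone : ‖(1 : B)‖ = 1 := by
    have : Nontrivial B := ⟨1, 0, fun h => by simpa [h] using hφ.1⟩
    exact CStarRing.norm_one
  rw [hone] at key
  by_contra hne
  have h := key ((‖a‖ ^ 2 + 1) / (2 * (φ a).im))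
  have h2 : 2 * (φ a).im * ((‖a‖ ^ 2 + 1) / (2 * (φ a).im)) = ‖a‖ ^ 2 + 1 := by
    field_simp
  nlinarith [sq_nonneg (φ a).im]

lemma IsState.map_star {φ : B →ₗ[ℂ] ℂ} (hφ : IsState φ) (b : B) :
    φ (star b) = star (φ b) := by
  have h1 := hφ.im_eq_zero (a := b + star b) (by simp [add_comm])
  have h2 := hφ.im_eq_zero (a := Complex.I • (b - star b)) (by
    simp [smul_sub]; abel)
  simp at h1 h2
  apply Complex.ext
  · simp; linarith
  · simp; linarith

lemma IsState.re_map_star_mul_self_nonneg {φ : B →ₗ[ℂ] ℂ} (hφ : IsState φ) (x : B) :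
    0 ≤ (φ (star x * x)).re := by
  let : CStarAlgebra B := { }
  let := CStarAlgebra.spectralOrder B
  have := CStarAlgebra.spectralOrderedRing B
  set c : ℝ := ‖x‖ ^ 2
  have hle : star x * x ≤ algebraMap ℝ B c := CStarAlgebra.star_mul_le_algebraMap_norm_sq
  have hnorm : ‖algebraMap ℝ B c - star x * x‖ ≤ c := by
    rw [CStarAlgebra.norm_le_iff_le_algebraMap _ (sq_nonneg _) (sub_nonneg.mpr hle)]
    exact sub_le_self _ (star_mul_self_nonneg x)
  have hc : φ (algebraMap ℝ B c) = c := by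
    rw [IsScalarTower.algebraMap_apply ℝ ℂ B, Algebra.algebraMap_eq_smul_one]
    simp [hφ.1]
  have := (Complex.re_le_norm _).trans ((hφ.2 _).trans hnorm)
  rw [map_sub, hc, Complex.sub_re, Complex.ofReal_re] at this
  linarith

/-- The sesquilinear form `(x, y) ↦ φ (x* y)` of a state, as a pre-inner product. -/
abbrev IsState.preInnerCore {φ : B →ₗ[ℂ] ℂ} (hφ : IsState φ) : PreInnerProductSpace.Core ℂ B where
  inner x y := φ (star x * y)
  conj_inner_symm x y := by
    change star (φ (star y * x)) = _
    rw [← hφ.map_star]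
    simp
  re_inner_nonneg x := hφ.re_map_star_mul_self_nonneg x
  add_left x y z := by simp [add_mul]
  smul_left x y r := by simp

/-- The Cauchy–Schwarz inequality for a state. -/
lemma IsState.norm_map_star_mul_sq_le {φ : B →ₗ[ℂ] ℂ} (hφ : IsState φ) (x y : B) :
    ‖φ (star x * y)‖ ^ 2 ≤ (φ (star x * x)).re * (φ (star y * y)).re := by
  have h : ‖φ (star x * y)‖ * ‖φ (star y * x)‖ ≤ (φ (star x * x)).re * (φ (star y * y)).re :=
    InnerProductSpace.Core.inner_mul_inner_self_le (c := hφ.preInnerCore) x y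
  have hs : φ (star y * x) = star (φ (star x * y)) := by
    rw [← hφ.map_star]
    simp
  rwa [hs, norm_star, ← sq] at h

lemma IsState.re_map_star_mul_self_le {φ : B →ₗ[ℂ] ℂ} (hφ : IsState φ) (x : B) :
    (φ (star x * x)).re ≤ ‖x‖ ^ 2 := by
  rw [sq, ← CStarRing.norm_star_mul_self]
  exact (Complex.re_le_norm _).trans (hφ.2 _)

lemma IsState.norm_map_star_mul_le {φ : B →ₗ[ℂ] ℂ} (hφ : IsState φ) (x y : B) :
    ‖φ (star x * y)‖ ≤ √(φ (star x * x)).re * ‖y‖ := by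
  refine (sq_le_sq₀ (norm_nonneg _) (by positivity)).mp ?_
  rw [mul_pow, Real.sq_sqrt (hφ.re_map_star_mul_self_nonneg x)]
  exact (hφ.norm_map_star_mul_sq_le x y).trans (mul_le_mul_of_nonneg_left
    (hφ.re_map_star_mul_self_le y) (hφ.re_map_star_mul_self_nonneg x))

/-- If a state is nearly `1` at a contraction `a`, then it is nearly invariant under
compression by `a`. -/
lemma IsState.norm_map_conjugate_sub_le {φ : B →ₗ[ℂ] ℂ} (hφ : IsState φ) {a : B} (ha : ‖a‖ ≤ 1)
    (b : B) : ‖φ (star a * b * a) - φ b‖ ≤ 2 * √(2 - 2 * (φ a).re) * ‖b‖ := by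
  have hd : (φ (star (a - 1) * (a - 1))).re ≤ 2 - 2 * (φ a).re := by
    have hexp : star (a - 1) * (a - 1) = star a * a - star a - a + 1 := by
      simp [sub_mul, mul_sub]
      abel
    have hle : (φ (star a * a)).re ≤ 1 :=
      (hφ.re_map_star_mul_self_le a).trans (pow_le_one₀ (norm_nonneg _) ha)
    rw [hexp, map_add, map_sub, map_sub, hφ.map_star, hφ.1]
    simp
    linarith
  have hleft (y : B) (hy : ‖y‖ ≤ ‖b‖) :
      ‖φ (star (a - 1) * y)‖ ≤ √(2 - 2 * (φ a).re) * ‖b‖ :=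
    (hφ.norm_map_star_mul_le _ y).trans (by gcongr)
  have h1 := hleft (b * a) ((norm_mul_le _ _).trans (mul_le_of_le_one_right (norm_nonneg _) ha))
  have h2 := hleft (star b) (norm_star b).le
  rw [← norm_star (φ _), ← hφ.map_star, star_mul, star_star, star_star] at h2
  have hsplit : φ (star a * b * a) - φ b = φ (star (a - 1) * (b * a)) + φ (b * (a - 1)) := by
    simp [sub_mul, mul_sub, mul_assoc]
  rw [hsplit]
  linarith [norm_add_le (φ (star (a - 1) * (b * a))) (φ (b * (a - 1)))]

/-- A state which tends to `1` along an excision of `ω` equals `ω`. -/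
lemma IsState.eq_of_tendsto_re {φ ω : B →ₗ[ℂ] ℂ} (hφ : IsState φ)
    {Λ : Type*} {l : Filter Λ} [l.NeBot] {e : Λ → B} (hcontr : ∀ i, ‖e i‖ ≤ 1)
    (hre : Filter.Tendsto (fun i => (φ (e i)).re) l (nhds 1))
    (hexc : ∀ b : B, Filter.Tendsto
      (fun i => ‖star (e i) * (b - ω b • (1 : B)) * e i‖) l (nhds 0)) :
    φ = ω := by
  ext b
  set c : B := b - ω b • (1 : B) with hc
  have h0 : Filter.Tendsto (fun i => φ (star (e i) * c * e i)) l (nhds 0) :=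
    squeeze_zero_norm (fun i => hφ.2 _) (hexc b)
  have h1 : Filter.Tendsto (fun i => φ (star (e i) * c * e i)) l (nhds (φ c)) := by
    rw [tendsto_iff_norm_sub_tendsto_zero]
    refine squeeze_zero (fun _ => norm_nonneg _)
      (fun i => hφ.norm_map_conjugate_sub_le (hcontr i) c) ?_
    simpa using ((((hre.const_mul 2).const_sub 2).sqrt).const_mul 2).mul_const ‖c‖
  have := tendsto_nhds_unique h1 h0
  simpa [hc, hφ.1, sub_eq_zero] using this

theorem stmt12 (ω : B →ₗ[ℂ] ℂ) (hω : IsState ω)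
    (Λ : Type*) [Preorder Λ] [Nonempty Λ] [IsDirected Λ (· ≤ ·)]
    (e : Λ → B) (hcontr : ∀ l, ‖e l‖ ≤ 1)
    (hlim1 : Filter.Tendsto (fun l => ω (e l)) Filter.atTop (nhds 1))
    (hlim2 : ∀ b : B, Filter.Tendsto
      (fun l => ‖star (e l) * (b - ω b • (1 : B)) * e l‖) Filter.atTop (nhds 0)) :
    IsPureState ω := by
  refine ⟨hω, fun φ₁ hφ₁ φ₂ hφ₂ hseg => ?_⟩
  obtain ⟨s, t, hs, ht, hst, rfl⟩ := hseg
  have hre : Filter.Tendsto (fun l => ((s • φ₁ + t • φ₂) (e l)).re) Filter.atTop (nhds 1) :=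
    (Complex.continuous_re.tendsto 1).comp hlim1
  refine hφ₁.eq_of_tendsto_re hcontr ?_ hlim2
  have hle (φ : B →ₗ[ℂ] ℂ) (hφ : IsState φ) (l : Λ) : (φ (e l)).re ≤ 1 :=
    (Complex.re_le_norm _).trans ((hφ.2 _).trans (hcontr l))
  have hlow : Filter.Tendsto (fun l => (((s • φ₁ + t • φ₂) (e l)).re - t) / s) Filter.atTop
      (nhds 1) := by
    have := (hre.sub_const t).div_const s
    rwa [← hst, add_sub_cancel_right, div_self hs.ne'] at this
  refine tendsto_of_tendsto_of_tendsto_of_le_of_le hlow tendsto_const_nhds (fun l => ?_)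
    (hle φ₁ hφ₁)
  have := mul_le_mul_of_nonneg_left (hle φ₂ hφ₂ l) ht.le
  rw [div_le_iff₀ hs]
  simp
  linarith
end
end
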